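/- arXiv:1401.5544 — 6 statements merged into one kernel-verified Lean document; each statement's English description precedes it below -/
import Mathlib

section
/- Let α : ℝ → ℝ be continuously differentiable with α(σ) > 0 for σ in an open interval containing the range of S, and let S : (0, π) → ℝ be differentiable and satisfy S'(φ)·sin φ = α(S(φ)) for all φ ∈ (0, π). Define φ(p) = arccos((1 − |p|²)/(1 + |p|²)) for p ∈ ℝ² and f(p) = ln( α(S(φ(p))) / |p| ) for p ≠ 0. Then for every p ∈ ℝ² with p ≠ 0, f is differentiable at p and its gradient is ∇f(p) = (α'(S(φ(p))) − 1) · p / |p|². -/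
open Real

/-- The polar angle `φ(p) = arccos((1 - |p|²)/(1 + |p|²))` on the sphere obtained by
inverse stereographic projection of `p ∈ ℝ²`. -/
noncomputable def polarPhi (p : EuclideanSpace ℝ (Fin 2)) : ℝ :=
  Real.arccos ((1 - ‖p‖ ^ 2) / (1 + ‖p‖ ^ 2))

/-- On the nonnegative half-line, stereographic projection has polar angle `2 arctan r`. -/
theorem arccos_one_sub_sq_div_one_add_sq {r : ℝ} (hr : 0 ≤ r) :
    Real.arccos ((1 - r ^ 2) / (1 + r ^ 2)) = 2 * Real.arctan r := by
  have hcos : (1 - r ^ 2) / (1 + r ^ 2) = Real.cos (2 * Real.arctan r) := by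
    rw [Real.cos_two_mul, Real.cos_sq_arctan]
    field_simp
    ring
  rw [hcos, Real.arccos_cos]
  · have := Real.arctan_nonneg.2 hr
    linarith
  · linarith [Real.arctan_lt_pi_div_two r]

theorem sin_two_mul_arctan_eq (r : ℝ) :
    Real.sin (2 * Real.arctan r) = 2 * r / (1 + r ^ 2) := by
  have hsin : Real.sin (Real.arctan r) = r * Real.cos (Real.arctan r) := by
    rw [Real.sin_arctan, Real.cos_arctan]
    ring
  rw [Real.sin_two_mul, hsin]
  linear_combination 2 * r * Real.cos_sq_arctan r

theorem hasFDerivAt_norm_of_ne_zero {E : Type*} [NormedAddCommGroup E] [InnerProductSpace ℝ E]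
    {p : E} (hp : p ≠ 0) : HasFDerivAt (fun x : E ↦ ‖x‖) (‖p‖⁻¹ • innerSL ℝ p) p := by
  have hp' : ‖p‖ ≠ 0 := norm_ne_zero_iff.2 hp
  have h := (hasStrictFDerivAt_norm_sq p).hasFDerivAt.sqrt (pow_ne_zero 2 hp')
  simp only [Real.sqrt_sq (norm_nonneg _)] at h
  convert h using 1
  ext v
  simp
  field_simp

/-- The conformal exponent as a function of the radius. -/
theorem hasDerivAt_log_conformal_factor {α S : ℝ → ℝ} {s r : ℝ} (hr : 0 < r)
    (hα : DifferentiableAt ℝ α (S (2 * Real.arctan r)))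
    (hpos : 0 < α (S (2 * Real.arctan r)))
    (hS : HasDerivAt S s (2 * Real.arctan r))
    (hode : s * Real.sin (2 * Real.arctan r) = α (S (2 * Real.arctan r))) :
    HasDerivAt (fun t ↦ Real.log (α (S (2 * Real.arctan t)) / t))
      ((deriv α (S (2 * Real.arctan r)) - 1) / r) r := by
  have hS' : HasDerivAt (fun t ↦ S (2 * Real.arctan t)) _ r :=
    HasDerivAt.comp r hS ((Real.hasDerivAt_arctan r).const_mul 2)
  have hαS : HasDerivAt (fun t ↦ α (S (2 * Real.arctan t))) _ r :=
    HasDerivAt.comp r hα.hasDerivAt hS'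
  have h := (hαS.div (hasDerivAt_id r) hr.ne').log (div_pos hpos hr).ne'
  refine h.congr_deriv ?_
  rw [sin_two_mul_arctan_eq] at hode
  have hs : s * (2 * (1 / (1 + r ^ 2))) = α (S (2 * Real.arctan r)) / r := by
    rw [← hode]
    field_simp
  simp only [hs, Pi.div_apply, id]
  field_simp

/-- If `α` is `C¹` and positive on an open interval `(A, B)` containing the
range of `S`, and `S` is differentiable on `(0, π)` with `S'(φ)·sin φ = α(S(φ))`, then the
conformal exponent `f(p) = ln(α(S(φ(p)))/|p|)` is differentiable at every `p ≠ 0`, with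
gradient `∇f(p) = (α'(S(φ(p))) − 1)·p/|p|²`. -/
theorem gradient_of_conformal_exponent
    (α S S' : ℝ → ℝ) (A B : ℝ)
    (hα : ContDiff ℝ 1 α)
    (hrange : ∀ φ ∈ Set.Ioo (0 : ℝ) π, S φ ∈ Set.Ioo A B)
    (hpos : ∀ σ ∈ Set.Ioo A B, 0 < α σ)
    (hS : ∀ φ ∈ Set.Ioo (0 : ℝ) π, HasDerivAt S (S' φ) φ)
    (hode : ∀ φ ∈ Set.Ioo (0 : ℝ) π, S' φ * Real.sin φ = α (S φ))
    (f : EuclideanSpace ℝ (Fin 2) → ℝ)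
    (hf : ∀ p, f p = Real.log (α (S (polarPhi p)) / ‖p‖)) :
    ∀ p : EuclideanSpace ℝ (Fin 2), p ≠ 0 →
      HasGradientAt f (((deriv α (S (polarPhi p)) - 1) / ‖p‖ ^ 2) • p) p := by
  intro p hp
  have hr : 0 < ‖p‖ := norm_pos_iff.2 hp
  have hφ (q : EuclideanSpace ℝ (Fin 2)) : polarPhi q = 2 * Real.arctan ‖q‖ :=
    arccos_one_sub_sq_div_one_add_sq (norm_nonneg q)
  have hmem : 2 * Real.arctan ‖p‖ ∈ Set.Ioo 0 π :=
    ⟨mul_pos two_pos (Real.arctan_pos.2 hr), by linarith [Real.arctan_lt_pi_div_two ‖p‖]⟩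
  have hradial := hasDerivAt_log_conformal_factor hr (hα.differentiable one_ne_zero _)
    (hpos _ (hrange _ hmem)) (hS _ hmem) (hode _ hmem)
  have h := hradial.comp_hasFDerivAt p (hasFDerivAt_norm_of_ne_zero hp)
  have hf' : f = (fun t ↦ Real.log (α (S (2 * Real.arctan t)) / t)) ∘ fun q ↦ ‖q‖ := by
    funext q
    simp only [hf, hφ, Function.comp_apply]
  rw [hasGradientAt_iff_hasFDerivAt, hf', hφ]
  refine h.congr_fderiv ?_
  ext v
  simp only [smul_apply, innerSL_apply_apply, map_smul, smul_eq_mul,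
    InnerProductSpace.toDual_apply_apply]
  field_simp
end

section
/- Fix an integer n ≥ 1 and a real r > 0. Let Θ_j = 2π(j−1)/n and p_j = r(cos Θ_j, sin Θ_j) for j = 1, …, n. Then Σ_{j=2}^{n} (p₁ − p_j)^⊥ / |p₁ − p_j|² = ((n−1)/2) · p₁^⊥ / r². -/
open Real

/-- A point of `ℝ²` (Euclidean). -/
noncomputable def e2 (x y : ℝ) : EuclideanSpace ℝ (Fin 2) :=
  (WithLp.equiv 2 (Fin 2 → ℝ)).symm ![x, y]

/-- The rotation `p^⊥ = (−y, x)` of `p = (x, y) ∈ ℝ²`. -/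
noncomputable def perp (p : EuclideanSpace ℝ (Fin 2)) : EuclideanSpace ℝ (Fin 2) :=
  e2 (-(p 1)) (p 0)

theorem sum_sin_div_one_sub_cos (n : ℕ) (hn : 1 ≤ n) :
    ∑ j ∈ Finset.Icc 2 n, Real.sin (2 * π * ((j : ℝ) - 1) / n) /
      (1 - Real.cos (2 * π * ((j : ℝ) - 1) / n)) = 0 := by
  have hn0 : (n : ℝ) ≠ 0 := by positivity
  rw [← self_eq_neg, ← Finset.sum_neg_distrib]
  refine Finset.sum_nbij' (fun j => n + 2 - j) (fun j => n + 2 - j) ?_ ?_ ?_ ?_ ?_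
  iterate 4
    · intro j hj
      simp only [Finset.mem_Icc] at *
      omega
  · intro j hj
    simp only [Finset.mem_Icc] at hj
    have angle_reflect : 2 * π * (((n + 2 - j : ℕ) : ℝ) - 1) / n
        = 2 * π - 2 * π * ((j : ℝ) - 1) / n := by
      rw [Nat.cast_sub (by omega)]
      push_cast
      field_simp
      ring
    rw [angle_reflect, Real.sin_two_pi_sub, Real.cos_two_pi_sub, neg_div, neg_neg]

theorem cos_two_pi_mul_div_ne_one {n j : ℕ} (h2 : 2 ≤ j) (hj : j ≤ n) :
    Real.cos (2 * π * ((j : ℝ) - 1) / n) ≠ 1 := by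
  have hn : (0 : ℝ) < n := by exact_mod_cast (by omega : 0 < n)
  have h2' : (2 : ℝ) ≤ j := by exact_mod_cast h2
  have hj' : (j : ℝ) ≤ n := by exact_mod_cast hj
  have hpos : 0 < 2 * π * ((j : ℝ) - 1) / n :=
    div_pos (mul_pos two_pi_pos (by linarith)) hn
  have hlt : 2 * π * ((j : ℝ) - 1) / n < 2 * π := by
    rw [div_lt_iff₀ hn]
    exact mul_lt_mul_of_pos_left (by linarith) two_pi_pos
  rw [Ne, Real.cos_eq_one_iff_of_lt_of_lt (by linarith [two_pi_pos]) hlt]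
  exact hpos.ne'

theorem smul_perp_sub_on_circle {r θ : ℝ} (hr : r ≠ 0) (hθ : Real.cos θ ≠ 1) :
    (1 / ‖e2 r 0 - e2 (r * Real.cos θ) (r * Real.sin θ)‖ ^ 2) •
        perp (e2 r 0 - e2 (r * Real.cos θ) (r * Real.sin θ))
      = e2 (1 / (2 * r) * (Real.sin θ / (1 - Real.cos θ))) (1 / (2 * r)) := by
  have hc : 1 - Real.cos θ ≠ 0 := sub_ne_zero.mpr hθ.symm
  have hnorm : ‖e2 r 0 - e2 (r * Real.cos θ) (r * Real.sin θ)‖ ^ 2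
      = 2 * r ^ 2 * (1 - Real.cos θ) := by
    simp only [EuclideanSpace.norm_sq_eq, Fin.sum_univ_two, e2, Real.norm_eq_abs, sq_abs]
    simp
    linear_combination r ^ 2 * Real.sin_sq_add_cos_sq θ
  rw [hnorm]
  ext i
  fin_cases i
  · simp [perp, e2]
    field_simp
  · simp [perp, e2]
    field_simp

/-- For `n` equally spaced points `p_j = r(cos Θ_j, sin Θ_j)`,
`Θ_j = 2π(j−1)/n`, on the circle of radius `r`, one has
`Σ_{j=2}^{n} (p₁ − p_j)^⊥/|p₁ − p_j|² = ((n−1)/2)·p₁^⊥/r²`. -/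
theorem ring_self_interaction_sum
    (n : ℕ) (hn : 1 ≤ n) (r : ℝ) (hr : 0 < r)
    (Θ : ℕ → ℝ) (hΘ : ∀ j, Θ j = 2 * π * ((j : ℝ) - 1) / n)
    (p : ℕ → EuclideanSpace ℝ (Fin 2))
    (hp : ∀ j, p j = e2 (r * Real.cos (Θ j)) (r * Real.sin (Θ j))) :
    ∑ j ∈ Finset.Icc 2 n, (1 / ‖p 1 - p j‖ ^ 2) • perp (p 1 - p j)
      = (((n : ℝ) - 1) / 2 / r ^ 2) • perp (p 1) := by
  have angle_first : Θ 1 = 0 := by simp [hΘ]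
  have point_first : p 1 = e2 r 0 := by simp [hp, angle_first]
  have term_eq : ∀ j ∈ Finset.Icc 2 n, (1 / ‖p 1 - p j‖ ^ 2) • perp (p 1 - p j)
      = e2 (1 / (2 * r) * (Real.sin (Θ j) / (1 - Real.cos (Θ j)))) (1 / (2 * r)) := by
    intro j hj
    rw [Finset.mem_Icc] at hj
    rw [point_first, hp j]
    exact smul_perp_sub_on_circle hr.ne' (hΘ j ▸ cos_two_pi_mul_div_ne_one hj.1 hj.2)
  rw [Finset.sum_congr rfl term_eq, point_first]
  ext i
  rw [WithLp.ofLp_sum, Finset.sum_apply]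
  fin_cases i
  · simp only [e2, perp, hΘ]
    simp [← Finset.mul_sum, sum_sin_div_one_sub_cos n hn]
  · simp [e2, perp]
    rw [Nat.cast_sub (by omega)]
    push_cast
    field_simp
end

section
/- Fix an integer n ≥ 1 and reals r₁, r₂ > 0 with r₁ ≠ r₂. Let Θ_j = 2π(j−1)/n, p₁ = (r₁, 0), and q_j = r₂(cos Θ_j, sin Θ_j) for j = 1, …, n. Then Σ_{j=1}^{n} (p₁ − q_j)^⊥ / |p₁ − q_j|² = ( 1/(r₁ − r₂) + Q(r₁, r₂)/2 ) · p₁^⊥ / r₁, where Q(r₁, r₂) = Σ_{j=2}^{⌊(n+1)/2⌋} 4(r₁ − r₂ cos Θ_j)/(r₁² + r₂² − 2 r₁ r₂ cos Θ_j) + 2/(r₁ + r₂) if n is even, and Q(r₁, r₂) = Σ_{j=2}^{⌊(n+1)/2⌋} 4(r₁ − r₂ cos Θ_j)/(r₁² + r₂² − 2 r₁ r₂ cos Θ_j) if n is odd. -/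
open Real

/-- The interaction coefficient
`Q(r₁, r₂) = Σ_{j=2}^{⌊(n+1)/2⌋} 4(r₁ − r₂ cos Θ_j)/(r₁² + r₂² − 2r₁r₂ cos Θ_j)`,
with `Θ_j = 2π(j−1)/n`, plus the additional term `2/(r₁ + r₂)` when `n` is even. -/
noncomputable def Qring (n : ℕ) (r₁ r₂ : ℝ) : ℝ :=
  (∑ j ∈ Finset.Icc 2 ((n + 1) / 2),
      4 * (r₁ - r₂ * Real.cos (2 * π * ((j : ℝ) - 1) / n)) /
        (r₁ ^ 2 + r₂ ^ 2 - 2 * r₁ * r₂ * Real.cos (2 * π * ((j : ℝ) - 1) / n)))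
    + (if Even n then 2 / (r₁ + r₂) else 0)

theorem e2_apply_zero (x y : ℝ) : e2 x y 0 = x := rfl

theorem e2_apply_one (x y : ℝ) : e2 x y 1 = y := rfl

theorem norm_sq_e2_sub (a b c d : ℝ) : ‖e2 a b - e2 c d‖ ^ 2 = (a - c) ^ 2 + (b - d) ^ 2 := by
  simp [EuclideanSpace.norm_sq_eq, Fin.sum_univ_two, e2_apply_zero, e2_apply_one]

/-- The reflection `j ↦ n + 2 - j` carries `[n + 2 - m, n]` onto `[2, m]`. -/
theorem sum_Icc_add_two_sub (n m : ℕ) (hm : m ≤ n) (f : ℕ → ℝ) :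
    ∑ j ∈ Finset.Icc (n + 2 - m) n, f j = ∑ j ∈ Finset.Icc 2 m, f (n + 2 - j) := by
  refine Finset.sum_nbij' (fun j => n + 2 - j) (fun j => n + 2 - j) ?_ ?_ ?_ ?_ ?_ <;>
    simp only [Finset.mem_Icc]
  · intros; omega
  · intros; omega
  · intros; omega
  · intros; omega
  · intro j hj
    congr 1
    omega

theorem sum_Icc_one_of_symm (n : ℕ) (hn : 1 ≤ n) (f : ℕ → ℝ)
    (hf : ∀ j ∈ Finset.Icc 2 n, f (n + 2 - j) = f j) :
    ∑ j ∈ Finset.Icc 1 n, f j =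
      f 1 + 2 * ∑ j ∈ Finset.Icc 2 ((n + 1) / 2), f j + if Even n then f (n / 2 + 1) else 0 := by
  have hrefl : ∑ j ∈ Finset.Icc (n + 2 - (n + 1) / 2) n, f j =
      ∑ j ∈ Finset.Icc 2 ((n + 1) / 2), f j := by
    rw [sum_Icc_add_two_sub n _ (by omega)]
    refine Finset.sum_congr rfl fun j hj => hf j ?_
    simp only [Finset.mem_Icc] at hj ⊢
    omega
  have hsplit : ∑ j ∈ Finset.Icc 1 n, f j = f 1 + ∑ j ∈ Finset.Icc 2 n, f j :=
    (Finset.add_sum_Ioc_eq_sum_Icc hn).symm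
  have hmid : ∑ j ∈ Finset.Icc 2 n, f j = ∑ j ∈ Finset.Icc 2 ((n + 1) / 2), f j +
      (∑ j ∈ Finset.Icc (n + 2 - (n + 1) / 2) n, f j + if Even n then f (n / 2 + 1) else 0) := by
    split_ifs with h
    · obtain ⟨m, rfl⟩ := h
      have hset : Finset.Icc 2 (m + m) = Finset.Icc 2 ((m + m + 1) / 2) ∪
          insert ((m + m) / 2 + 1) (Finset.Icc (m + m + 2 - (m + m + 1) / 2) (m + m)) := by
        ext j
        simp only [Finset.mem_Icc, Finset.mem_union, Finset.mem_insert]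
        omega
      rw [hset, Finset.sum_union, Finset.sum_insert, add_comm (f _)]
      · simp only [Finset.mem_Icc]
        omega
      · rw [Finset.disjoint_left]
        intro j
        simp only [Finset.mem_Icc, Finset.mem_insert]
        omega
    · rw [Nat.not_even_iff_odd] at h
      obtain ⟨m, rfl⟩ := h
      have hset : Finset.Icc 2 (2 * m + 1) = Finset.Icc 2 ((2 * m + 1 + 1) / 2) ∪
          Finset.Icc (2 * m + 1 + 2 - (2 * m + 1 + 1) / 2) (2 * m + 1) := by
        ext j
        simp only [Finset.mem_Icc, Finset.mem_union]
        omega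
      rw [hset, Finset.sum_union, add_zero]
      rw [Finset.disjoint_left]
      intro j
      simp only [Finset.mem_Icc]
      omega
  rw [hsplit, hmid, hrefl]
  ring

theorem sum_Icc_one_of_antisymm (n : ℕ) (hn : 1 ≤ n) (f : ℕ → ℝ) (hf₁ : f 1 = 0)
    (hf : ∀ j ∈ Finset.Icc 2 n, f (n + 2 - j) = -f j) :
    ∑ j ∈ Finset.Icc 1 n, f j = 0 := by
  have hsplit : ∑ j ∈ Finset.Icc 1 n, f j = f 1 + ∑ j ∈ Finset.Icc 2 n, f j :=
    (Finset.add_sum_Ioc_eq_sum_Icc hn).symm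
  have hneg : ∑ j ∈ Finset.Icc 2 n, f j = -∑ j ∈ Finset.Icc 2 n, f j := by
    rw [← Finset.sum_neg_distrib, ← Finset.sum_congr rfl hf, ← sum_Icc_add_two_sub n n le_rfl]
    simp
  linarith

theorem angle_add_two_sub {n j : ℕ} (hj : j ∈ Finset.Icc 2 n) :
    2 * π * (((n + 2 - j : ℕ) : ℝ) - 1) / n = 2 * π - 2 * π * ((j : ℝ) - 1) / n := by
  rw [Finset.mem_Icc] at hj
  have : (n : ℝ) ≠ 0 := by
    norm_cast
    omega
  rw [Nat.cast_sub (by omega)]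
  push_cast
  field_simp
  ring

/-- For `p₁ = (r₁, 0)` and the `n` equally spaced points
`q_j = r₂(cos Θ_j, sin Θ_j)` on the circle of radius `r₂`,
`Σ_{j=1}^{n} (p₁ − q_j)^⊥/|p₁ − q_j|² = (1/(r₁ − r₂) + Q(r₁, r₂)/2)·p₁^⊥/r₁`. -/
theorem ring_cross_interaction_sum
    (n : ℕ) (hn : 1 ≤ n) (r₁ r₂ : ℝ) (hr₁ : 0 < r₁) (hr₂ : 0 < r₂) (hne : r₁ ≠ r₂)
    (Θ : ℕ → ℝ) (hΘ : ∀ j, Θ j = 2 * π * ((j : ℝ) - 1) / n)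
    (p₁ : EuclideanSpace ℝ (Fin 2)) (hp₁ : p₁ = e2 r₁ 0)
    (q : ℕ → EuclideanSpace ℝ (Fin 2))
    (hq : ∀ j, q j = e2 (r₂ * Real.cos (Θ j)) (r₂ * Real.sin (Θ j))) :
    ∑ j ∈ Finset.Icc 1 n, (1 / ‖p₁ - q j‖ ^ 2) • perp (p₁ - q j)
      = ((1 / (r₁ - r₂) + Qring n r₁ r₂ / 2) / r₁) • perp p₁ := by
  obtain rfl : Θ = fun j : ℕ => 2 * π * ((j : ℝ) - 1) / n := funext hΘ
  have hcos : ∀ j ∈ Finset.Icc 2 n, cos (2 * π * (((n + 2 - j : ℕ) : ℝ) - 1) / n) =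
      cos (2 * π * ((j : ℝ) - 1) / n) := fun j hj => by
    rw [angle_add_two_sub hj, cos_two_pi_sub]
  have hsin : ∀ j ∈ Finset.Icc 2 n, sin (2 * π * (((n + 2 - j : ℕ) : ℝ) - 1) / n) =
      -sin (2 * π * ((j : ℝ) - 1) / n) := fun j hj => by
    rw [angle_add_two_sub hj, sin_two_pi_sub]
  have hnorm : ∀ j, ‖p₁ - q j‖ ^ 2 =
      r₁ ^ 2 + r₂ ^ 2 - 2 * r₁ * r₂ * cos (2 * π * ((j : ℝ) - 1) / n) := fun j => by
    rw [hp₁, hq, norm_sq_e2_sub]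
    linear_combination r₂ ^ 2 * sin_sq_add_cos_sq (2 * π * ((j : ℝ) - 1) / n)
  ext i
  rw [WithLp.ofLp_sum, Finset.sum_apply]
  fin_cases i
  · have hzero := sum_Icc_one_of_antisymm n hn
      (fun j => r₂ * sin (2 * π * ((j : ℝ) - 1) / n) /
        (r₁ ^ 2 + r₂ ^ 2 - 2 * r₁ * r₂ * cos (2 * π * ((j : ℝ) - 1) / n))) (by simp)
      (fun j hj => by
        simp only [hcos j hj, hsin j hj]
        ring)
    simp only [hnorm]
    simpa [hp₁, hq, perp, e2_apply_zero, e2_apply_one, div_eq_inv_mul] using hzero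
  · have hsum := sum_Icc_one_of_symm n hn
      (fun j => (r₁ - r₂ * cos (2 * π * ((j : ℝ) - 1) / n)) /
        (r₁ ^ 2 + r₂ ^ 2 - 2 * r₁ * r₂ * cos (2 * π * ((j : ℝ) - 1) / n)))
      (fun j hj => by simp only [hcos j hj])
    have hlhs : ∀ j, ((1 / ‖p₁ - q j‖ ^ 2) • perp (p₁ - q j)) 1 =
        (r₁ - r₂ * cos (2 * π * ((j : ℝ) - 1) / n)) /
          (r₁ ^ 2 + r₂ ^ 2 - 2 * r₁ * r₂ * cos (2 * π * ((j : ℝ) - 1) / n)) := fun j => by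
      rw [hnorm]
      simp [hp₁, hq, perp, e2_apply_zero, e2_apply_one, div_eq_inv_mul]
    have hrhs : (((1 / (r₁ - r₂) + Qring n r₁ r₂ / 2) / r₁) • perp p₁) 1 =
        1 / (r₁ - r₂) + Qring n r₁ r₂ / 2 := by
      simp [hp₁, perp, e2_apply_zero, e2_apply_one, hr₁.ne']
    have hsub : r₁ - r₂ ≠ 0 := sub_ne_zero.mpr hne
    have hadd : r₁ + r₂ ≠ 0 := (add_pos hr₁ hr₂).ne'
    have hfirst : (r₁ - r₂ * cos (2 * π * (((1 : ℕ) : ℝ) - 1) / n)) /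
        (r₁ ^ 2 + r₂ ^ 2 - 2 * r₁ * r₂ * cos (2 * π * (((1 : ℕ) : ℝ) - 1) / n)) =
        1 / (r₁ - r₂) := by
      simp only [Nat.cast_one, sub_self, mul_zero, zero_div, cos_zero, mul_one]
      rw [show r₁ ^ 2 + r₂ ^ 2 - 2 * r₁ * r₂ = (r₁ - r₂) ^ 2 by ring]
      field_simp
    have hmid : Even n → (r₁ - r₂ * cos (2 * π * (((n / 2 + 1 : ℕ) : ℝ) - 1) / n)) /
        (r₁ ^ 2 + r₂ ^ 2 - 2 * r₁ * r₂ * cos (2 * π * (((n / 2 + 1 : ℕ) : ℝ) - 1) / n)) =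
        1 / (r₁ + r₂) := fun h => by
      have hangle : 2 * π * (((n / 2 + 1 : ℕ) : ℝ) - 1) / n = π := by
        have : (n : ℝ) ≠ 0 := by
          norm_cast
          omega
        rw [Nat.cast_add, Nat.cast_div h.two_dvd (by norm_num)]
        push_cast
        field_simp
        ring
      rw [hangle, cos_pi,
        show r₁ ^ 2 + r₂ ^ 2 - 2 * r₁ * r₂ * -1 = (r₁ + r₂) ^ 2 by ring]
      field_simp
      ring
    refine (Finset.sum_congr rfl fun j _ => hlhs j).trans (Eq.trans ?_ hrhs.symm)
    rw [hsum, hfirst, Qring]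
    simp only [mul_div_assoc (4 : ℝ), ← Finset.mul_sum]
    split_ifs with h
    · rw [hmid h]
      ring
    · ring
end

section
/- Fix an integer n ≥ 1, a real b, and reals r₁, r₂ > 0 with r₁ ≠ r₂. With Q as defined below, the two bracket expressions arising in the rotating two-ring vortex system cancel: [ n − b − 2r₁/(r₁ − r₂) − r₁ Q(r₁, r₂) ] + [ n + b + 2r₂/(r₁ − r₂) − r₂ Q(r₂, r₁) ] = 0. Consequently, whenever the conformal data of the two rings satisfy α₁ = α₂ and α₁' = −α₂', the compatibility equation −(1/α₁²)[ n − α₁' − 2r₁/(r₁ − r₂) − r₁ Q(r₁, r₂) ] = (1/α₂²)[ n − α₂' + 2r₂/(r₁ − r₂) − r₂ Q(r₂, r₁) ] holds automatically. -/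
open Real

lemma ring_pair_term {r₁ r₂ c : ℝ} (hr₁ : 0 < r₁) (hr₂ : 0 < r₂) (hne : r₁ ≠ r₂) (hc : c ≤ 1) :
    r₁ * (4 * (r₁ - r₂ * c) / (r₁ ^ 2 + r₂ ^ 2 - 2 * r₁ * r₂ * c))
      + r₂ * (4 * (r₂ - r₁ * c) / (r₂ ^ 2 + r₁ ^ 2 - 2 * r₂ * r₁ * c)) = 4 := by
  have h₁ : 0 < (r₁ - r₂) ^ 2 := by have := sub_ne_zero.2 hne; positivity
  have h₂ : 0 ≤ r₁ * r₂ * (1 - c) := mul_nonneg (mul_pos hr₁ hr₂).le (sub_nonneg.2 hc)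
  have hD : r₁ ^ 2 + r₂ ^ 2 - 2 * r₁ * r₂ * c ≠ 0 := ne_of_gt (by nlinarith only [h₁, h₂])
  have hD' : r₂ ^ 2 + r₁ ^ 2 - 2 * r₂ * r₁ * c = r₁ ^ 2 + r₂ ^ 2 - 2 * r₁ * r₂ * c := by ring
  rw [hD', mul_div_assoc', mul_div_assoc', ← add_div, div_eq_iff hD]
  ring

lemma Qring_weighted_add {n : ℕ} (hn : 1 ≤ n) {r₁ r₂ : ℝ}
    (hr₁ : 0 < r₁) (hr₂ : 0 < r₂) (hne : r₁ ≠ r₂) :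
    r₁ * Qring n r₁ r₂ + r₂ * Qring n r₂ r₁ = 2 * n - 2 := by
  unfold Qring
  rw [mul_add, mul_add, add_add_add_comm, Finset.mul_sum, Finset.mul_sum,
    ← Finset.sum_add_distrib,
    Finset.sum_congr rfl fun j _ => ring_pair_term hr₁ hr₂ hne (Real.cos_le_one _),
    Finset.sum_const, Nat.card_Icc, nsmul_eq_mul]
  rcases Nat.even_or_odd' n with ⟨m, rfl | rfl⟩
  · have hcard : (2 * m + 1) / 2 + 1 - 2 = m - 1 := by omega
    have hsum : r₁ + r₂ ≠ 0 := (add_pos hr₁ hr₂).ne'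
    have hm : 1 ≤ m := by omega
    rw [hcard, if_pos (even_two_mul m), if_pos (even_two_mul m), add_comm r₂ r₁, ← add_mul,
      mul_div_cancel₀ _ hsum]
    push_cast [hm]
    ring
  · have hcard : (2 * m + 1 + 1) / 2 + 1 - 2 = m := by omega
    have hodd : ¬ Even (2 * m + 1) := Nat.not_even_two_mul_add_one m
    rw [hcard, if_neg hodd, if_neg hodd]
    push_cast
    ring

/-- The two bracket expressions of the rotating two-ring vortex system
cancel:
`[n − b − 2r₁/(r₁−r₂) − r₁Q(r₁,r₂)] + [n + b + 2r₂/(r₁−r₂) − r₂Q(r₂,r₁)] = 0`;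
consequently, whenever `α₁ = α₂ > 0` and `α₁' = −α₂'`, the compatibility equation
`−(1/α₁²)[n − α₁' − 2r₁/(r₁−r₂) − r₁Q(r₁,r₂)] = (1/α₂²)[n − α₂' + 2r₂/(r₁−r₂) − r₂Q(r₂,r₁)]`
holds automatically. -/
theorem bracket_cancellation
    (n : ℕ) (hn : 1 ≤ n) (b r₁ r₂ : ℝ)
    (hr₁ : 0 < r₁) (hr₂ : 0 < r₂) (hne : r₁ ≠ r₂) :
    (((n : ℝ) - b - 2 * r₁ / (r₁ - r₂) - r₁ * Qring n r₁ r₂)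
      + ((n : ℝ) + b + 2 * r₂ / (r₁ - r₂) - r₂ * Qring n r₂ r₁) = 0) ∧
    (∀ α₁ α₂ α₁' α₂' : ℝ, 0 < α₁ → 0 < α₂ → α₁ = α₂ → α₁' = -α₂' →
      -(1 / α₁ ^ 2) * ((n : ℝ) - α₁' - 2 * r₁ / (r₁ - r₂) - r₁ * Qring n r₁ r₂)
        = (1 / α₂ ^ 2) * ((n : ℝ) - α₂' + 2 * r₂ / (r₁ - r₂) - r₂ * Qring n r₂ r₁)) := by
  have hQ := Qring_weighted_add hn hr₁ hr₂ hne
  have hdiv : 2 * r₁ / (r₁ - r₂) - 2 * r₂ / (r₁ - r₂) = 2 := by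
    rw [← sub_div, div_eq_iff (sub_ne_zero.2 hne)]
    ring
  refine ⟨by linarith, ?_⟩
  rintro α₁ α₂ α₁' α₂' - - rfl rfl
  linear_combination (1 / α₁ ^ 2) * (hQ + hdiv)
end

section
/- Fix an integer n ≥ 1. Let a₁, a₂ > 0, b₁, b₂ ∈ ℝ, and let r₁, r₂ > 0 with r₁ ≠ r₂ satisfy −(1/a₁²)[ n − b₁ − 2r₁/(r₁ − r₂) − r₁ Q(r₁, r₂) ] = (1/a₂²)[ n − b₂ + 2r₂/(r₁ − r₂) − r₂ Q(r₂, r₁) ]. Set Θ_i = 2π(i−1)/n, d_i = 1 and a(i) = a₁, b(i) = b₁ for 1 ≤ i ≤ n, and d_i = −1 and a(i) = a₂, b(i) = b₂ for n+1 ≤ i ≤ 2n. Then there exists ω₀ ∈ ℝ such that the curves p_i(t) = r₁(cos(Θ_i + ω₀ t), sin(Θ_i + ω₀ t)) for 1 ≤ i ≤ n and p_i(t) = r₂(cos(Θ_{i−n} + ω₀ t), sin(Θ_{i−n} + ω₀ t)) for n+1 ≤ i ≤ 2n satisfy, for all t ∈ ℝ and all 1 ≤ i ≤ 2n, d_i p_i'(t)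 = (|p_i|²/a(i)²)[ (1 − b(i)) p_i^⊥/|p_i|² + 2 Σ_{j ≠ i} d_i d_j (p_i − p_j)^⊥/|p_i − p_j|² ]. -/
open Real

theorem norm_sq_e2 (x y : ℝ) : ‖e2 x y‖ ^ 2 = x ^ 2 + y ^ 2 := by
  simp [EuclideanSpace.norm_sq_eq, Fin.sum_univ_two, e2_apply_zero, e2_apply_one]

theorem norm_sq_circle (r α : ℝ) : ‖e2 (r * cos α) (r * sin α)‖ ^ 2 = r ^ 2 := by
  rw [norm_sq_e2]
  linear_combination r ^ 2 * sin_sq_add_cos_sq α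

theorem perp_circle (r α : ℝ) :
    perp (e2 (r * cos α) (r * sin α)) = r • e2 (-sin α) (cos α) := by
  ext i
  fin_cases i <;> simp [perp, e2_apply_zero, e2_apply_one]

theorem perp_zero : perp 0 = 0 := by
  ext i
  fin_cases i <;> simp [perp, e2_apply_zero, e2_apply_one]

theorem perp_sub_circle (R S α θ : ℝ) :
    perp (e2 (R * cos α) (R * sin α) - e2 (S * cos (α + θ)) (S * sin (α + θ))) =
      (R - S * cos θ) • e2 (-sin α) (cos α) + (S * sin θ) • e2 (cos α) (sin α) := by
  ext i
  fin_cases i <;> simp [perp, e2_apply_zero, e2_apply_one, cos_add, sin_add] <;> ring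

theorem norm_sq_sub_circle (R S α θ : ℝ) :
    ‖e2 (R * cos α) (R * sin α) - e2 (S * cos (α + θ)) (S * sin (α + θ))‖ ^ 2 =
      R ^ 2 + S ^ 2 - 2 * R * S * cos θ := by
  have h : e2 (R * cos α) (R * sin α) - e2 (S * cos (α + θ)) (S * sin (α + θ)) =
      e2 (R * cos α - S * cos (α + θ)) (R * sin α - S * sin (α + θ)) := by
    ext i
    fin_cases i <;> simp [e2_apply_zero, e2_apply_one]
  rw [h, norm_sq_e2, cos_add, sin_add]
  linear_combination (R ^ 2 - 2 * R * S * cos θ + S ^ 2 * (sin θ ^ 2 + cos θ ^ 2)) *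
    sin_sq_add_cos_sq α + S ^ 2 * sin_sq_add_cos_sq θ

theorem hasDerivAt_circle (r c ω t : ℝ) :
    HasDerivAt (fun s : ℝ => e2 (r * cos (c + ω * s)) (r * sin (c + ω * s)))
      ((r * ω) • e2 (-sin (c + ω * t)) (cos (c + ω * t))) t := by
  have hdecomp : ∀ x y : ℝ, e2 x y = x • e2 1 0 + y • e2 0 1 := by
    intro x y
    ext i
    fin_cases i <;> simp [e2_apply_zero, e2_apply_one]
  have hlin : HasDerivAt (fun s : ℝ => c + ω * s) ω t := by
    simpa using ((hasDerivAt_id t).const_mul ω).const_add c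
  have hc := (hlin.cos.const_mul r).smul_const (e2 1 0)
  have hs := (hlin.sin.const_mul r).smul_const (e2 0 1)
  have h := hc.add hs
  have hf : (fun s : ℝ => e2 (r * cos (c + ω * s)) (r * sin (c + ω * s))) =
      (fun s : ℝ => (r * cos (c + ω * s)) • e2 1 0) +
        fun s : ℝ => (r * sin (c + ω * s)) • e2 0 1 := by
    funext s
    exact hdecomp _ _
  rw [hf]
  refine h.congr_deriv ?_
  rw [hdecomp (-sin (c + ω * t))]
  module

/-- Sums over `n` equally spaced sample points of a periodic function do not change when the
sample points are shifted by one of them. -/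
theorem sum_equally_spaced_shift {f : ℝ → ℝ} {c : ℝ} (hf : Function.Periodic f c)
    {n : ℕ} (hn : n ≠ 0) (m : ℕ) :
    ∑ k ∈ Finset.range n, f (c * k / n - c * m / n) = ∑ k ∈ Finset.range n, f (c * k / n) := by
  have hn' : (n : ℝ) ≠ 0 := Nat.cast_ne_zero.mpr hn
  have hH : Function.Periodic (fun x => ∑ k ∈ Finset.range n, f (x + k * (c / n))) (c / n) := by
    intro x
    have h1 := Finset.sum_range_succ (fun k : ℕ => f (x + k * (c / n))) n
    have h2 := Finset.sum_range_succ' (fun k : ℕ => f (x + k * (c / n))) n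
    have h3 : f (x + n * (c / n)) = f x := by
      rw [mul_div_cancel₀ _ hn', hf x]
    have h4 : ∀ k : ℕ, x + ((k + 1 : ℕ) : ℝ) * (c / n) = x + c / n + k * (c / n) := by
      intro k
      push_cast
      ring
    simp only [h4, h3, Nat.cast_zero, zero_mul, add_zero] at h1 h2
    simp only
    linarith
  have h := hH.sub_nat_mul_eq (x := 0) m
  simp only [zero_add] at h
  calc _ = ∑ k ∈ Finset.range n, f (0 - m * (c / n) + k * (c / n)) :=
        Finset.sum_congr rfl fun k _ => by congr 1; ring
    _ = ∑ k ∈ Finset.range n, f (k * (c / n)) := h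
    _ = _ := Finset.sum_congr rfl fun k _ => by congr 1; ring

theorem sum_Icc_equally_spaced {f : ℝ → ℝ} (hf : Function.Periodic f (2 * π))
    {n i : ℕ} (hn : n ≠ 0) (hi : 1 ≤ i) :
    ∑ j ∈ Finset.Icc 1 n, f (2 * π * ((j : ℝ) - 1) / n - 2 * π * ((i : ℝ) - 1) / n) =
      ∑ k ∈ Finset.range n, f (2 * π * k / n) := by
  obtain ⟨m, rfl⟩ := Nat.exists_eq_add_of_le hi
  rw [← sum_equally_spaced_shift hf hn m, ← Finset.Ico_add_one_right_eq_Icc,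
    Finset.sum_Ico_eq_sum_range]
  simp

/-- A sum over equally spaced points of the circle of an odd periodic function vanishes. -/
theorem sum_equally_spaced_odd {f : ℝ → ℝ} (hf : Function.Periodic f (2 * π))
    (hodd : ∀ x, f (-x) = -f x) {n : ℕ} (hn : n ≠ 0) :
    ∑ k ∈ Finset.range n, f (2 * π * k / n) = 0 := by
  have hn' : (n : ℝ) ≠ 0 := Nat.cast_ne_zero.mpr hn
  have h : ∑ k ∈ Finset.range n, f (2 * π * k / n) =
      -∑ k ∈ Finset.range n, f (2 * π * k / n) := by
    calc _ = ∑ k ∈ Finset.range n, f (2 * π * ((n - 1 - k : ℕ) : ℝ) / n) :=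
          (Finset.sum_range_reflect (fun k : ℕ => f (2 * π * k / n)) n).symm
      _ = ∑ k ∈ Finset.range n, -f (2 * π * k / n - 2 * π * ((n - 1 : ℕ) : ℝ) / n) := by
          refine Finset.sum_congr rfl fun k hk => ?_
          rw [← hodd]
          congr 1
          rw [Nat.cast_sub (by have := Finset.mem_range.mp hk; omega)]
          ring
      _ = _ := by rw [Finset.sum_neg_distrib, sum_equally_spaced_shift hf hn]
  linarith

/-- A sum over `ℤ/n` of an even function, folded onto half of the indices. -/
theorem sum_range_fold {f : ℕ → ℝ} {n : ℕ} (hn : n ≠ 0)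
    (hf : ∀ k, 0 < k → k < n → f (n - k) = f k) :
    ∑ k ∈ Finset.range n, f k =
      f 0 + 2 * ∑ j ∈ Finset.Icc 2 ((n + 1) / 2), f (j - 1) +
        if Even n then f (n / 2) else 0 := by
  have hIcc : ∀ m : ℕ, ∑ j ∈ Finset.Icc 2 (m + 1), f (j - 1) =
      ∑ k ∈ Finset.range m, f (k + 1) := by
    intro m
    rw [← Finset.Ico_add_one_right_eq_Icc, Finset.sum_Ico_eq_sum_range]
    refine Finset.sum_congr (by congr 1) fun k _ => ?_
    congr 1
    omega
  have hrefl : ∀ m l : ℕ, n = l + m + 1 → ∑ k ∈ Finset.range m, f (l + 1 + k) =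
      ∑ k ∈ Finset.range m, f (k + 1) := by
    intro m l h
    rw [← Finset.sum_range_reflect]
    refine Finset.sum_congr rfl fun k hk => ?_
    have hk' := Finset.mem_range.mp hk
    rw [← hf (k + 1) (by omega) (by omega)]
    congr 1
    omega
  rcases Nat.even_or_odd' n with ⟨m, h | h⟩
  · obtain ⟨q, rfl⟩ : ∃ q, m = q + 1 := ⟨m - 1, by omega⟩
    have heven : Even n := ⟨q + 1, by omega⟩
    rw [if_pos heven, show (n + 1) / 2 = q + 1 by omega, show n / 2 = q + 1 by omega, hIcc,
      show n = (q + 1 + 1) + q by omega, Finset.sum_range_add, Finset.sum_range_succ,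
      Finset.sum_range_succ', hrefl q (q + 1) (by omega)]
    ring
  · have hodd : ¬ Even n := by
      rw [Nat.not_even_iff_odd]
      exact ⟨m, h⟩
    rw [if_neg hodd, show (n + 1) / 2 = m + 1 by omega, hIcc,
      show n = (m + 1) + m by omega, Finset.sum_range_add,
      Finset.sum_range_succ', hrefl m m (by omega)]
    ring

/-- The tangential interaction of two points on concentric circles of radii `R` and `S`, at
angular distance `θ`. -/
noncomputable def ringKernel (R S θ : ℝ) : ℝ :=
  (R - S * cos θ) / (R ^ 2 + S ^ 2 - 2 * R * S * cos θ)

theorem sum_ringKernel_self {R : ℝ} (hR : R ≠ 0) {n : ℕ} (hn : n ≠ 0) :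
    ∑ k ∈ Finset.range n, ringKernel R R (2 * π * k / n) = ((n : ℝ) - 1) / (2 * R) := by
  obtain ⟨m, rfl⟩ := Nat.exists_eq_succ_of_ne_zero hn
  have hterm : ∀ k ∈ Finset.range m,
      ringKernel R R (2 * π * ((k + 1 : ℕ) : ℝ) / (m.succ : ℕ)) = 1 / (2 * R) := by
    intro k hk
    have hkm : ((k + 1 : ℕ) : ℝ) < (m.succ : ℕ) := by
      have := Finset.mem_range.mp hk
      exact_mod_cast Nat.succ_lt_succ this
    have hm : (0 : ℝ) < (m.succ : ℕ) := by positivity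
    have hpos : 0 < 2 * π * ((k + 1 : ℕ) : ℝ) / (m.succ : ℕ) := by positivity
    have hlt : 2 * π * ((k + 1 : ℕ) : ℝ) / (m.succ : ℕ) < 2 * π := by
      rw [div_lt_iff₀ hm]
      exact mul_lt_mul_of_pos_left hkm (by positivity)
    have hcos : cos (2 * π * ((k + 1 : ℕ) : ℝ) / (m.succ : ℕ)) ≠ 1 := by
      intro h
      rw [cos_eq_one_iff_of_lt_of_lt (by linarith [pi_pos]) hlt] at h
      exact hpos.ne' h
    unfold ringKernel
    generalize cos (2 * π * ((k + 1 : ℕ) : ℝ) / (m.succ : ℕ)) = c at hcos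
    have h1 : 1 - c ≠ 0 := sub_ne_zero.mpr hcos.symm
    rw [show R - R * c = R * (1 - c) by ring,
      show R ^ 2 + R ^ 2 - 2 * R * R * c = 2 * R * (R * (1 - c)) by ring]
    field_simp
  rw [Finset.sum_range_succ', Finset.sum_congr rfl hterm]
  simp [ringKernel]
  ring

theorem sum_ringKernel {R S : ℝ} (hR : 0 < R) (hS : 0 < S) (hne : R ≠ S) {n : ℕ} (hn : n ≠ 0) :
    ∑ k ∈ Finset.range n, ringKernel R S (2 * π * k / n) = 1 / (R - S) + Qring n R S / 2 := by
  have hn' : (n : ℝ) ≠ 0 := Nat.cast_ne_zero.mpr hn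
  rw [sum_range_fold (f := fun k : ℕ => ringKernel R S (2 * π * k / n)) hn ?_]
  · have hzero : ringKernel R S (2 * π * (0 : ℕ) / n) = 1 / (R - S) := by
      have h : R - S ≠ 0 := sub_ne_zero.mpr hne
      simp only [ringKernel, Nat.cast_zero, mul_zero, zero_div, cos_zero, mul_one]
      rw [show R ^ 2 + S ^ 2 - 2 * R * S = (R - S) * (R - S) by ring]
      field_simp
    have hmid : (if Even n then ringKernel R S (2 * π * (n / 2 : ℕ) / n) else 0) =
        (if Even n then 2 / (R + S) else 0) / 2 := by
      split_ifs with h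
      · have hangle : 2 * π * (n / 2 : ℕ) / n = π := by
          rw [Nat.cast_div h.two_dvd two_ne_zero]
          push_cast
          field_simp
        have hpos : R + S ≠ 0 := by positivity
        rw [hangle, ringKernel, cos_pi,
          show R ^ 2 + S ^ 2 - 2 * R * S * -1 = (R + S) * (R + S) by ring,
          show R - S * -1 = R + S by ring]
        field_simp
      · simp
    have hsum : ∑ j ∈ Finset.Icc 2 ((n + 1) / 2), 4 * (R - S * cos (2 * π * ((j : ℝ) - 1) / n)) /
          (R ^ 2 + S ^ 2 - 2 * R * S * cos (2 * π * ((j : ℝ) - 1) / n)) =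
        4 * ∑ j ∈ Finset.Icc 2 ((n + 1) / 2), ringKernel R S (2 * π * ((j - 1 : ℕ) : ℝ) / n) := by
      rw [Finset.mul_sum]
      refine Finset.sum_congr rfl fun j hj => ?_
      rw [Nat.cast_sub (by have := (Finset.mem_Icc.mp hj).1; omega), Nat.cast_one, ringKernel,
        mul_div_assoc]
    rw [hzero, hmid, Qring, hsum]
    ring
  · intro k _ hk
    have hangle : 2 * π * ((n - k : ℕ) : ℝ) / n = 2 * π - 2 * π * k / n := by
      rw [Nat.cast_sub hk.le]
      field_simp
    simp only [ringKernel, hangle, cos_two_pi_sub]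

/-- The velocity induced by a ring of radius `S` at a point of radius `R` aligned with one of
its vertices is tangential. -/
theorem sum_perp_ring (R S φ : ℝ) {n i : ℕ} (hn : n ≠ 0) (hi : 1 ≤ i) {Θ : ℕ → ℝ}
    (hΘ : ∀ i, Θ i = 2 * π * ((i : ℝ) - 1) / n) {P : EuclideanSpace ℝ (Fin 2)}
    (hP : P = e2 (R * cos (Θ i + φ)) (R * sin (Θ i + φ)))
    {q : ℕ → EuclideanSpace ℝ (Fin 2)}
    (hq : ∀ j ∈ Finset.Icc 1 n, q j = e2 (S * cos (Θ j + φ)) (S * sin (Θ j + φ))) (σ : ℝ) :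
    ∑ j ∈ Finset.Icc 1 n, (σ / ‖P - q j‖ ^ 2) • perp (P - q j) =
      (σ * ∑ k ∈ Finset.range n, ringKernel R S (2 * π * k / n)) •
        e2 (-sin (Θ i + φ)) (cos (Θ i + φ)) := by
  set g : ℝ → ℝ := fun θ => S * sin θ / (R ^ 2 + S ^ 2 - 2 * R * S * cos θ) with hg
  have hgper : Function.Periodic g (2 * π) := by
    intro θ
    simp [hg]
  have hgodd : ∀ θ, g (-θ) = -g θ := by
    intro θ
    simp only [hg, sin_neg, cos_neg]
    ring
  have hkper : Function.Periodic (ringKernel R S) (2 * π) := by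
    intro θ
    simp [ringKernel]
  have hterm : ∀ j ∈ Finset.Icc 1 n, (σ / ‖P - q j‖ ^ 2) • perp (P - q j) =
      (σ * ringKernel R S (2 * π * ((j : ℝ) - 1) / n - 2 * π * ((i : ℝ) - 1) / n)) •
        e2 (-sin (Θ i + φ)) (cos (Θ i + φ)) +
      (σ * g (2 * π * ((j : ℝ) - 1) / n - 2 * π * ((i : ℝ) - 1) / n)) •
        e2 (cos (Θ i + φ)) (sin (Θ i + φ)) := by
    intro j hj
    rw [← hΘ, ← hΘ, hP, hq j hj, show Θ j + φ = Θ i + φ + (Θ j - Θ i) by ring,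
      perp_sub_circle, norm_sq_sub_circle]
    simp only [ringKernel, hg]
    module
  rw [Finset.sum_congr rfl hterm, Finset.sum_add_distrib, ← Finset.sum_smul, ← Finset.sum_smul,
    ← Finset.mul_sum, ← Finset.mul_sum, sum_Icc_equally_spaced hkper hn hi,
    sum_Icc_equally_spaced hgper hn hi, sum_equally_spaced_odd hgper hgodd hn]
  simp

theorem sum_Icc_two_mul {M : Type*} [AddCommMonoid M] (n : ℕ) (f : ℕ → M) :
    ∑ j ∈ Finset.Icc 1 (2 * n), f j =
      ∑ j ∈ Finset.Icc 1 n, f j + ∑ j ∈ Finset.Icc 1 n, f (n + j) := by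
  simp only [← Finset.Ico_add_one_right_eq_Icc, Finset.sum_Ico_eq_sum_range, Nat.add_sub_cancel]
  rw [two_mul, Finset.sum_range_add]
  congr 1
  exact Finset.sum_congr rfl fun k _ => by congr 1; omega

/-- If the radii `r₁ ≠ r₂` of the two rings satisfy the compatibility
equation
`−(1/a₁²)[n − b₁ − 2r₁/(r₁−r₂) − r₁Q(r₁,r₂)] = (1/a₂²)[n − b₂ + 2r₂/(r₁−r₂) − r₂Q(r₂,r₁)]`,
then there is an angular speed `ω₀` such that the two rotating rings of `n` equally spaced
vortices, `p_i(t) = r₁(cos(Θ_i + ω₀t), sin(Θ_i + ω₀t))` with degree `+1` for `1 ≤ i ≤ n`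
and `p_i(t) = r₂(cos(Θ_{i−n} + ω₀t), sin(Θ_{i−n} + ω₀t))` with degree `−1` for
`n+1 ≤ i ≤ 2n`, solve the generalized point-vortex system
`d_i p_i' = (|p_i|²/a(i)²)[(1 − b(i)) p_i^⊥/|p_i|² + 2 Σ_{j≠i} d_i d_j (p_i−p_j)^⊥/|p_i−p_j|²]`. -/
theorem rotating_two_ring_vortex_solution
    (n : ℕ) (hn : 1 ≤ n)
    (a₁ a₂ b₁ b₂ r₁ r₂ : ℝ) (ha₁ : 0 < a₁) (ha₂ : 0 < a₂)
    (hr₁ : 0 < r₁) (hr₂ : 0 < r₂) (hne : r₁ ≠ r₂)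
    (hcompat : -(1 / a₁ ^ 2) * ((n : ℝ) - b₁ - 2 * r₁ / (r₁ - r₂) - r₁ * Qring n r₁ r₂)
      = (1 / a₂ ^ 2) * ((n : ℝ) - b₂ + 2 * r₂ / (r₁ - r₂) - r₂ * Qring n r₂ r₁))
    (Θ : ℕ → ℝ) (hΘ : ∀ i, Θ i = 2 * π * ((i : ℝ) - 1) / n)
    (d a b : ℕ → ℝ)
    (hd : ∀ i, d i = if i ≤ n then 1 else -1)
    (ha : ∀ i, a i = if i ≤ n then a₁ else a₂)
    (hb : ∀ i, b i = if i ≤ n then b₁ else b₂) :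
    ∃ ω₀ : ℝ, ∀ p : ℕ → ℝ → EuclideanSpace ℝ (Fin 2),
      (∀ i ∈ Finset.Icc 1 n, ∀ t : ℝ,
        p i t = e2 (r₁ * Real.cos (Θ i + ω₀ * t)) (r₁ * Real.sin (Θ i + ω₀ * t))) →
      (∀ i ∈ Finset.Icc (n + 1) (2 * n), ∀ t : ℝ,
        p i t = e2 (r₂ * Real.cos (Θ (i - n) + ω₀ * t)) (r₂ * Real.sin (Θ (i - n) + ω₀ * t))) →
      ∀ t : ℝ, ∀ i ∈ Finset.Icc 1 (2 * n),
        d i • deriv (p i) t = (‖p i t‖ ^ 2 / (a i) ^ 2) •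
          (((1 - b i) / ‖p i t‖ ^ 2) • perp (p i t)
            + (2 : ℝ) • ∑ j ∈ (Finset.Icc 1 (2 * n)).erase i,
                ((d i * d j) / ‖p i t - p j t‖ ^ 2) • perp (p i t - p j t)) := by
  have hn0 : n ≠ 0 := by omega
  refine ⟨1 / a₁ ^ 2 * ((n : ℝ) - b₁ - 2 * r₁ / (r₁ - r₂) - r₁ * Qring n r₁ r₂), ?_⟩
  set ω : ℝ := 1 / a₁ ^ 2 * ((n : ℝ) - b₁ - 2 * r₁ / (r₁ - r₂) - r₁ * Qring n r₁ r₂) with hω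
  have hω₂ : -ω = 1 / a₂ ^ 2 * ((n : ℝ) - b₂ + 2 * r₂ / (r₁ - r₂) - r₂ * Qring n r₂ r₁) := by
    rw [← hcompat, hω]
    ring
  intro p hp₁ hp₂ t i hi
  have hinner : ∀ j ∈ Finset.Icc 1 n,
      p j t = e2 (r₁ * cos (Θ j + ω * t)) (r₁ * sin (Θ j + ω * t)) :=
    fun j hj => hp₁ j hj t
  have houter : ∀ j ∈ Finset.Icc 1 n, ∀ s,
      p (n + j) s = e2 (r₂ * cos (Θ j + ω * s)) (r₂ * sin (Θ j + ω * s)) := by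
    intro j hj s
    have hj' := Finset.mem_Icc.mp hj
    rw [hp₂ (n + j) (Finset.mem_Icc.mpr ⟨by omega, by omega⟩) s, Nat.add_sub_cancel_left]
  have hd₁ : ∀ j ∈ Finset.Icc 1 n, d j = 1 := fun j hj => by
    rw [hd, if_pos (Finset.mem_Icc.mp hj).2]
  have hd₂ : ∀ j ∈ Finset.Icc 1 n, d (n + j) = -1 := fun j hj => by
    have hj' := Finset.mem_Icc.mp hj
    rw [hd, if_neg (by omega)]
  have h12 : r₁ - r₂ ≠ 0 := sub_ne_zero.mpr hne
  have h21 : r₂ - r₁ ≠ 0 := sub_ne_zero.mpr hne.symm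
  rw [Finset.sum_erase _ (by rw [sub_self, perp_zero, smul_zero]), sum_Icc_two_mul]
  rcases Nat.lt_or_ge n i with hin | hin
  · obtain ⟨k, rfl⟩ := Nat.exists_eq_add_of_lt hin
    have hk : k + 1 ∈ Finset.Icc 1 n := by
      have := Finset.mem_Icc.mp hi
      exact Finset.mem_Icc.mpr ⟨by omega, by omega⟩
    rw [add_assoc]
    have hsame : ∑ j ∈ Finset.Icc 1 n, (d (n + (k + 1)) * d (n + j) /
        ‖p (n + (k + 1)) t - p (n + j) t‖ ^ 2) • perp (p (n + (k + 1)) t - p (n + j) t) = _ :=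
      (Finset.sum_congr rfl fun j hj => by rw [hd₂ _ hk, hd₂ j hj]).trans
        (sum_perp_ring r₂ r₂ (ω * t) hn0 (Finset.mem_Icc.mp hk).1 hΘ (houter _ hk t)
          (fun j hj => houter j hj t) (-1 * -1))
    have hcross : ∑ j ∈ Finset.Icc 1 n, (d (n + (k + 1)) * d j /
        ‖p (n + (k + 1)) t - p j t‖ ^ 2) • perp (p (n + (k + 1)) t - p j t) = _ :=
      (Finset.sum_congr rfl fun j hj => by rw [hd₂ _ hk, hd₁ j hj]).trans
        (sum_perp_ring r₂ r₁ (ω * t) hn0 (Finset.mem_Icc.mp hk).1 hΘ (houter _ hk t)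
          hinner (-1 * 1))
    rw [hsame, hcross, sum_ringKernel_self hr₂.ne' hn0, sum_ringKernel hr₂ hr₁ hne.symm hn0,
      funext (houter _ hk), (hasDerivAt_circle _ _ _ _).deriv, norm_sq_circle, perp_circle,
      hd₂ _ hk, ha, hb, if_neg (by omega), if_neg (by omega)]
    simp only [smul_smul, ← add_smul]
    congr 1
    rw [show -1 * (r₂ * ω) = r₂ * -ω by ring, hω₂,
      show (r₁ - r₂) = -(r₂ - r₁) by ring]
    field_simp
    ring
  · have hk : i ∈ Finset.Icc 1 n := Finset.mem_Icc.mpr ⟨(Finset.mem_Icc.mp hi).1, hin⟩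
    have hsame : ∑ j ∈ Finset.Icc 1 n, (d i * d j / ‖p i t - p j t‖ ^ 2) •
        perp (p i t - p j t) = _ :=
      (Finset.sum_congr rfl fun j hj => by rw [hd₁ _ hk, hd₁ j hj]).trans
        (sum_perp_ring r₁ r₁ (ω * t) hn0 (Finset.mem_Icc.mp hk).1 hΘ (hinner _ hk)
          hinner (1 * 1))
    have hcross : ∑ j ∈ Finset.Icc 1 n, (d i * d (n + j) / ‖p i t - p (n + j) t‖ ^ 2) •
        perp (p i t - p (n + j) t) = _ :=
      (Finset.sum_congr rfl fun j hj => by rw [hd₁ _ hk, hd₂ j hj]).trans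
        (sum_perp_ring r₁ r₂ (ω * t) hn0 (Finset.mem_Icc.mp hk).1 hΘ (hinner _ hk)
          (fun j hj => houter j hj t) (1 * -1))
    rw [hsame, hcross, sum_ringKernel_self hr₁.ne' hn0, sum_ringKernel hr₁ hr₂ hne hn0,
      funext (hp₁ i hk), (hasDerivAt_circle _ _ _ _).deriv, norm_sq_circle, perp_circle,
      hd₁ _ hk, ha, hb, if_pos hin, if_pos hin]
    simp only [smul_smul, ← add_smul]
    congr 1
    rw [hω]
    field_simp
    ring
end

section
/- Let l > 0 and let α : ℝ → ℝ be continuously differentiable with α(s) = α(l − s) for all s. Suppose S : (0, π) → (0, l) is differentiable, satisfies S'(φ)·sin φ = α(S(φ)) for all φ ∈ (0, π), and S(π/2) = l/2. Then S(π − φ) = l − S(φ) for all φ ∈ (0, π). -/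
open Real

/-- If `f` is `K`-Lipschitz on `s`, then the right-hand sides `x ↦ f x / sin t` are Lipschitz on `s`
with one constant for all `t` in `[a, π - a]`. -/
theorem lipschitzOnWith_div_sin {f : ℝ → ℝ} {s : Set ℝ} {K : NNReal} (hf : LipschitzOnWith K f s)
    {a t : ℝ} (ha : 0 < a) (ht : t ∈ Set.Icc a (π - a)) :
    LipschitzOnWith (K / (Real.sin a).toNNReal) (fun x ↦ f x / Real.sin t) s := by
  have ha' : 2 * a ≤ π := by linarith [ht.1, ht.2]
  have hsa : 0 < Real.sin a := sin_pos_of_pos_of_lt_pi ha (by linarith [pi_pos])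
  have hle : Real.sin a ≤ Real.sin t := by
    have := strictConcaveOn_sin_Icc.concaveOn.min_le_of_mem_Icc (x := a) (y := π - a)
      ⟨ha.le, by linarith⟩ ⟨by linarith, by linarith⟩ ht
    simpa using this
  refine LipschitzOnWith.of_dist_le_mul fun x hx y hy ↦ ?_
  have h := hf.dist_le_mul x hx y hy
  rw [Real.dist_eq] at h ⊢
  rw [← sub_div, abs_div, abs_of_pos (hsa.trans_le hle), NNReal.coe_div,
    Real.coe_toNNReal _ hsa.le, div_mul_eq_mul_div]
  gcongr

/-- If the profile `α` is `C¹` and symmetric (`α(s) = α(l − s)`), and the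
conformal latitude function `S : (0, π) → (0, l)` satisfies `S'(φ)·sin φ = α(S(φ))` together
with the normalization `S(π/2) = l/2`, then `S(π − φ) = l − S(φ)` on `(0, π)`. -/
theorem latitude_function_symmetric
    (l : ℝ) (hl : 0 < l) (α S S' : ℝ → ℝ)
    (hα : ContDiff ℝ 1 α)
    (hαsym : ∀ s : ℝ, α s = α (l - s))
    (hmaps : ∀ φ ∈ Set.Ioo (0 : ℝ) π, S φ ∈ Set.Ioo 0 l)
    (hS : ∀ φ ∈ Set.Ioo (0 : ℝ) π, HasDerivAt S (S' φ) φ)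
    (hode : ∀ φ ∈ Set.Ioo (0 : ℝ) π, S' φ * Real.sin φ = α (S φ))
    (hmid : S (π / 2) = l / 2) :
    ∀ φ ∈ Set.Ioo (0 : ℝ) π, S (π - φ) = l - S φ := by
  obtain ⟨K, hK⟩ := (hα.locallyLipschitz.locallyLipschitzOn (s := Set.Icc 0 l)
    ).exists_lipschitzOnWith_of_compact isCompact_Icc
  have hderiv : ∀ t ∈ Set.Ioo 0 π, HasDerivAt S (α (S t) / Real.sin t) t := fun t ht ↦ by
    rw [← hode t ht, mul_div_cancel_right₀ _ (sin_pos_of_mem_Ioo ht).ne']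
    exact hS t ht
  have hrefl : ∀ t ∈ Set.Ioo 0 π, π - t ∈ Set.Ioo 0 π := fun t ht ↦
    ⟨by linarith [ht.2], by linarith [ht.1]⟩
  intro φ hφ
  obtain ⟨a, ha, haφ⟩ := exists_between (lt_min hφ.1 (hrefl φ hφ).1)
  obtain ⟨h₁, h₂⟩ := lt_min_iff.1 haφ
  have hsub : ∀ t ∈ Set.Ioo a (π - a), t ∈ Set.Ioo 0 π := fun t ht ↦
    ⟨ha.trans ht.1, by linarith [ht.2]⟩
  have heq : Set.EqOn S (fun t ↦ l - S (π - t)) (Set.Ioo a (π - a)) := by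
    refine ODE_solution_unique_of_mem_Ioo (v := fun t x ↦ α x / Real.sin t)
      (s := fun _ ↦ Set.Icc 0 l) (t₀ := π / 2)
      (fun t ht ↦ lipschitzOnWith_div_sin hK ha (Set.Ioo_subset_Icc_self ht))
      ⟨by linarith, by linarith⟩
      (fun t ht ↦ ⟨hderiv t (hsub t ht), Set.Ioo_subset_Icc_self (hmaps t (hsub t ht))⟩)
      (fun t ht ↦ ⟨?_, ?_⟩) ?_
    · have h := ((hderiv _ (hrefl t (hsub t ht))).comp_const_sub π t).const_sub l
      rwa [neg_neg, hαsym, sin_pi_sub] at h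
    · have h := hmaps _ (hrefl t (hsub t ht))
      exact ⟨by linarith [h.2], by linarith [h.1]⟩
    · rw [show π - π / 2 = π / 2 by ring, hmid]
      ring
  have h := heq ⟨h₁, by linarith⟩
  linarith
end
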